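/- arXiv:2203.09871 — 3 statements merged into one kernel-verified Lean document; each statement's English description precedes it below -/
import Mathlib

section
/- Let p ≥ 1, m ≥ p, q ≥ 0, and let 0 = ω_0 < ω_1 < … < ω_q be real numbers. Let G_1 = diag(0_p, ω_1Ω_p, …, ω_qΩ_p) ∈ ℝ^{p(2q+1)×p(2q+1)} with Ω_p = [[0_p, I_p], [−I_p, 0_p]]. Given matrices P_0 ∈ ℂ^{p×m} and P_k^+, P_k^− ∈ ℂ^{p×m} for k = 1,…,q, each of full row rank p, let B_1 ∈ ℂ^{p(2q+1)×m} be the block matrix whose first block row is P_0 and whose subsequent block rows for each k are (P_k^+ + P_k^−)/2 and (iP_k^+ − iP_k^−)/2. Then there exists a matrix K_1 ∈ ℂ^{m×p(2q+1)} such that G_1 + B_1K_1 is Hurwitz, i.e., every eigenvalue of G_1 + B_1K_1 has strictly negative real part. -/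
/-- The rotation-generator block `Ω_p = [[0, I], [-I, 0]]`, as a complex matrix. -/
def OmegaBlockC (p : ℕ) : Matrix (Fin p ⊕ Fin p) (Fin p ⊕ Fin p) ℂ :=
  Matrix.fromBlocks 0 1 (-1) 0

/-- The internal model matrix `G₁ = diag(0_p, ω₁ Ω_p, …, ω_q Ω_p)` regarded as a
complex matrix, on the index type `Fin p ⊕ ((Fin p ⊕ Fin p) × Fin q)`
(of cardinality `p(2q+1)`). -/
noncomputable def GoneC (p q : ℕ) (ω : Fin (q + 1) → ℝ) :
    Matrix (Fin p ⊕ ((Fin p ⊕ Fin p) × Fin q)) (Fin p ⊕ ((Fin p ⊕ Fin p) × Fin q)) ℂ :=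
  Matrix.fromBlocks 0 0 0 (Matrix.blockDiagonal fun k => (ω k.succ : ℂ) • OmegaBlockC p)

/-- The input matrix `B₁` of the internal model, built from the transfer function
values `P₀ = P_K(0)` and `P_k^± = P_K(±iω_k)`: the first block row is `P₀` and the
subsequent block rows for each `k` are `(P_k^+ + P_k^-)/2` and `(i P_k^+ - i P_k^-)/2`. -/
noncomputable def Bone (p q m : ℕ) (P0 : Matrix (Fin p) (Fin m) ℂ)
    (Pp Pm : Fin q → Matrix (Fin p) (Fin m) ℂ) :
    Matrix (Fin p ⊕ ((Fin p ⊕ Fin p) × Fin q)) (Fin m) ℂ :=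
  Matrix.of fun i j =>
    match i with
    | Sum.inl i' => P0 i' j
    | Sum.inr (Sum.inl i', k) => (((1 : ℂ) / 2) • (Pp k + Pm k)) i' j
    | Sum.inr (Sum.inr i', k) =>
        (((1 : ℂ) / 2) • (Complex.I • Pp k - Complex.I • Pm k)) i' j

open Matrix ComplexOrder in
/-- A left-sided Lyapunov argument: if `G` is skew-Hermitian and no nonzero left eigenvector of `G`
is annihilated by `B`, then the feedback `-Bᴴ` makes `G` Hurwitz. -/
theorem re_neg_of_mem_spectrum_sub_mul_conjTranspose {n m : Type*} [Fintype n] [DecidableEq n]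
    [Fintype m] (G : Matrix n n ℂ) (B : Matrix n m ℂ) (hG : Gᴴ = -G)
    (hGB : ∀ (lam : ℂ) (y : n → ℂ), y ᵥ* G = lam • y → y ᵥ* B = 0 → y = 0)
    {lam : ℂ} (hlam : lam ∈ spectrum ℂ (G + B * -Bᴴ)) : lam.re < 0 := by
  rw [spectrum.mem_iff, Matrix.isUnit_iff_isUnit_det, isUnit_iff_ne_zero, not_not,
    ← Matrix.exists_vecMul_eq_zero_iff] at hlam
  obtain ⟨y, hy0, hy⟩ := hlam
  have heig : y ᵥ* G - (y ᵥ* B) ᵥ* Bᴴ = lam • y := by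
    rw [Matrix.vecMul_sub, sub_eq_zero, Algebra.algebraMap_eq_smul_one, Matrix.vecMul_smul,
      Matrix.vecMul_one, Matrix.vecMul_add, Matrix.mul_neg, Matrix.vecMul_neg,
      ← Matrix.vecMul_vecMul, ← sub_eq_add_neg] at hy
    exact hy.symm
  have hskew : ((y ᵥ* G) ⬝ᵥ star y).re = 0 := by
    have h : star ((y ᵥ* G) ⬝ᵥ star y) = -((y ᵥ* G) ⬝ᵥ star y) := by
      rw [← Matrix.star_dotProduct_star, star_star, Matrix.star_vecMul, hG, Matrix.neg_mulVec,
        dotProduct_neg, Matrix.dotProduct_mulVec]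
    have := congrArg Complex.re h
    simp only [Complex.star_def, Complex.conj_re, Complex.neg_re] at this
    linarith
  have hB : ((y ᵥ* B) ᵥ* Bᴴ) ⬝ᵥ star y = (y ᵥ* B) ⬝ᵥ star (y ᵥ* B) := by
    rw [← Matrix.dotProduct_mulVec, Matrix.star_vecMul]
  have hquad := congrArg (fun v => (v ⬝ᵥ star y).re) heig
  simp only [sub_dotProduct, smul_dotProduct, hB, Complex.sub_re, hskew, smul_eq_mul] at hquad
  have hy_pos : 0 < y ⬝ᵥ star y := Matrix.dotProduct_self_star_pos_iff.2 hy0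
  have hyB_nonneg : 0 ≤ (y ᵥ* B) ⬝ᵥ star (y ᵥ* B) := dotProduct_self_star_nonneg _
  obtain ⟨hy_re, hy_im⟩ := Complex.lt_def.1 hy_pos
  obtain ⟨hyB_re, hyB_im⟩ := Complex.le_def.1 hyB_nonneg
  simp only [Complex.zero_re, Complex.zero_im] at hy_re hy_im hyB_re hyB_im
  rw [Complex.mul_re, ← hy_im] at hquad
  by_contra! hre
  have hzero : (y ᵥ* B) ⬝ᵥ star (y ᵥ* B) = 0 := by
    refine Complex.ext ?_ hyB_im.symm
    have := mul_nonneg hre hy_re.le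
    simp only [Complex.zero_re]
    linarith
  have hyB : y ᵥ* B = 0 := dotProduct_self_star_eq_zero.1 hzero
  rw [hyB, Matrix.zero_vecMul, sub_zero] at heig
  exact hy0 (hGB lam y heig hyB)

open Matrix in
/-- A matrix of full row rank has trivial left kernel. -/
theorem eq_zero_of_vecMul_eq_zero_of_rank_eq {p m : ℕ} {M : Matrix (Fin p) (Fin m) ℂ}
    (hM : M.rank = p) {w : Fin p → ℂ} (hw : w ᵥ* M = 0) : w = 0 := by
  have hli : LinearIndependent ℂ M.row := by
    rw [linearIndependent_iff_card_eq_finrank_span, Fintype.card_fin, Set.finrank,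
      ← Matrix.rank_eq_finrank_span_row, hM]
  exact Matrix.vecMul_injective_iff.2 hli (by simpa using hw)

open Matrix in
/-- If the `w i` are eigenvectors (or zero) for one value `lam` but for pairwise distinct
frequencies `μ i`, at most one is nonzero, so full row rank forces all of them to vanish. -/
theorem eq_zero_of_sum_vecMul_eq_zero {ι : Type*} [Fintype ι] {p m : ℕ} {μ : ι → ℂ}
    (hμ : Function.Injective μ) {M : ι → Matrix (Fin p) (Fin m) ℂ} (hM : ∀ i, (M i).rank = p)
    {lam : ℂ} {w : ι → Fin p → ℂ} (hw : ∀ i, lam • w i = μ i • w i)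
    (hsum : ∑ i, w i ᵥ* M i = 0) (i : ι) : w i = 0 := by
  by_contra hi
  have hzero : ∀ j, w j ≠ 0 → lam = μ j := fun j hj => smul_left_injective ℂ hj (hw j)
  rw [Fintype.sum_eq_single i] at hsum
  · exact hi (eq_zero_of_vecMul_eq_zero_of_rank_eq (hM i) hsum)
  · intro j hji
    have : w j = 0 := by
      by_contra hj
      exact hji (hμ ((hzero j hj).symm.trans (hzero i hi)))
    rw [this, Matrix.zero_vecMul]

open Matrix in
theorem conjTranspose_GoneC (p q : ℕ) (ω : Fin (q + 1) → ℝ) : (GoneC p q ω)ᴴ = -GoneC p q ω := by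
  rw [GoneC, Matrix.fromBlocks_conjTranspose, Matrix.fromBlocks_neg,
    Matrix.blockDiagonal_conjTranspose, ← Matrix.blockDiagonal_neg]
  simp only [Matrix.conjTranspose_zero, neg_zero]
  congr 2
  funext k
  simp [OmegaBlockC, Matrix.fromBlocks_conjTranspose, Matrix.fromBlocks_neg,
    Matrix.fromBlocks_smul]

open Matrix in
/-- The Popov–Belevitch–Hautus test for the pair `(G₁, B₁)`. -/
theorem eq_zero_of_vecMul_GoneC_of_vecMul_Bone (p q m : ℕ)
    (ω : Fin (q + 1) → ℝ) (hω0 : ω 0 = 0) (hωmono : StrictMono ω)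
    (P0 : Matrix (Fin p) (Fin m) ℂ) (Pp Pm : Fin q → Matrix (Fin p) (Fin m) ℂ)
    (hP0 : P0.rank = p) (hPp : ∀ k, (Pp k).rank = p) (hPm : ∀ k, (Pm k).rank = p)
    (lam : ℂ) (y : Fin p ⊕ ((Fin p ⊕ Fin p) × Fin q) → ℂ)
    (hG : y ᵥ* GoneC p q ω = lam • y) (hB : y ᵥ* Bone p q m P0 Pp Pm = 0) : y = 0 := by
  have hpos : ∀ k : Fin q, 0 < ω k.succ := fun k => hω0 ▸ hωmono k.succ_pos
  have hG0 : ∀ i, lam * y (.inl i) = 0 := fun i => by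
    have := congrFun hG (.inl i)
    simpa [GoneC, Matrix.vecMul, dotProduct] using this.symm
  have hGa : ∀ i k, lam * y (.inr (.inl i, k)) = -(ω k.succ * y (.inr (.inr i, k))) := fun i k => by
    have := congrFun hG (.inr (.inl i, k))
    simpa [GoneC, OmegaBlockC, Matrix.vecMul, dotProduct, Fintype.sum_prod_type,
      Matrix.blockDiagonal_apply, Matrix.one_apply, mul_comm] using this.symm
  have hGb : ∀ i k, lam * y (.inr (.inr i, k)) = ω k.succ * y (.inr (.inl i, k)) := fun i k => by
    have := congrFun hG (.inr (.inr i, k))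
    simpa [GoneC, OmegaBlockC, Matrix.vecMul, dotProduct, Fintype.sum_prod_type,
      Matrix.blockDiagonal_apply, Matrix.one_apply, mul_comm] using this.symm
  let μ : Unit ⊕ (Fin q ⊕ Fin q) → ℝ :=
    Sum.elim (fun _ => 0) (Sum.elim (fun k => ω k.succ) fun k => -ω k.succ)
  let M : Unit ⊕ (Fin q ⊕ Fin q) → Matrix (Fin p) (Fin m) ℂ :=
    Sum.elim (fun _ => P0) (Sum.elim Pp Pm)
  let w : Unit ⊕ (Fin q ⊕ Fin q) → Fin p → ℂ :=
    Sum.elim (fun _ i => y (.inl i)) (Sum.elim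
      (fun k i => 1 / 2 * (y (.inr (.inl i, k)) + Complex.I * y (.inr (.inr i, k))))
      (fun k i => 1 / 2 * (y (.inr (.inl i, k)) - Complex.I * y (.inr (.inr i, k)))))
  have hμ : Function.Injective μ := by
    have hinj : ∀ j k : Fin q, ω j.succ = ω k.succ → j = k :=
      fun j k h => Fin.succ_injective _ (hωmono.injective h)
    rintro (_ | j | j) (_ | k | k) h <;> simp only [μ, Sum.elim_inl, Sum.elim_inr] at h
    · rfl
    · linarith [hpos k]
    · linarith [hpos k]
    · linarith [hpos j]
    · rw [hinj j k h]
    · linarith [hpos j, hpos k]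
    · linarith [hpos j]
    · linarith [hpos j, hpos k]
    · rw [hinj j k (neg_injective h)]
  have hμI : Function.Injective fun s => Complex.I * (μ s : ℂ) := fun s t h =>
    hμ (Complex.ofReal_injective (mul_left_cancel₀ Complex.I_ne_zero h))
  have hM : ∀ s, (M s).rank = p := by
    rintro (_ | k | k)
    exacts [hP0, hPp k, hPm k]
  have hw : ∀ s, lam • w s = (Complex.I * (μ s : ℂ)) • w s := by
    rintro (_ | k | k) <;> funext i <;>
      simp only [w, μ, Sum.elim_inl, Sum.elim_inr, Pi.smul_apply, smul_eq_mul, Complex.ofReal_neg,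
        Complex.ofReal_zero, mul_zero, zero_mul]
    · exact hG0 i
    · linear_combination 1 / 2 * hGa i k + Complex.I / 2 * hGb i k
        - ω k.succ * y (.inr (.inr i, k)) / 2 * Complex.I_mul_I
    · linear_combination 1 / 2 * hGa i k - Complex.I / 2 * hGb i k
        - ω k.succ * y (.inr (.inr i, k)) / 2 * Complex.I_mul_I
  have hsum : ∑ s, w s ᵥ* M s = 0 := by
    funext j
    rw [← hB]
    simp only [Fintype.sum_sum_type, Finset.univ_unique, Finset.sum_singleton, w, M, Sum.elim_inl,
      Sum.elim_inr, Finset.sum_apply, Matrix.vecMul, dotProduct, Bone,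
      Matrix.of_apply, Fintype.sum_prod_type, Matrix.smul_apply, Matrix.add_apply,
      Matrix.sub_apply, smul_eq_mul]
    congr 1
    simp only [← Finset.sum_add_distrib]
    rw [Finset.sum_comm]
    refine Finset.sum_congr rfl fun i _ => Finset.sum_congr rfl fun k _ => ?_
    ring
  have hzero := eq_zero_of_sum_vecMul_eq_zero hμI hM hw hsum
  have hu : ∀ i k, 1 / 2 * (y (.inr (.inl i, k)) + Complex.I * y (.inr (.inr i, k))) = 0 :=
    fun i k => congrFun (hzero (.inr (.inl k))) i
  have hv : ∀ i k, 1 / 2 * (y (.inr (.inl i, k)) - Complex.I * y (.inr (.inr i, k))) = 0 :=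
    fun i k => congrFun (hzero (.inr (.inr k))) i
  funext s
  rcases s with i | ⟨i | i, k⟩
  · exact congrFun (hzero (.inl ())) i
  · simp only [Pi.zero_apply]
    linear_combination hu i k + hv i k
  · simp only [Pi.zero_apply]
    linear_combination -Complex.I * hu i k + Complex.I * hv i k
      + y (.inr (.inr i, k)) * Complex.I_mul_I

/-- If `P₀` and all `P_k^±` have full row rank `p`, then there exists a feedback
matrix `K₁` such that `G₁ + B₁ K₁` is Hurwitz, i.e. every eigenvalue of
`G₁ + B₁ K₁` has strictly negative real part. -/
theorem internal_model_stabilizable (p q m : ℕ) (hp : 1 ≤ p) (hm : p ≤ m)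
    (ω : Fin (q + 1) → ℝ) (hω0 : ω 0 = 0) (hωmono : StrictMono ω)
    (P0 : Matrix (Fin p) (Fin m) ℂ) (Pp Pm : Fin q → Matrix (Fin p) (Fin m) ℂ)
    (hP0 : P0.rank = p) (hPp : ∀ k, (Pp k).rank = p) (hPm : ∀ k, (Pm k).rank = p) :
    ∃ K1 : Matrix (Fin m) (Fin p ⊕ ((Fin p ⊕ Fin p) × Fin q)) ℂ,
      ∀ lam ∈ spectrum ℂ (GoneC p q ω + Bone p q m P0 Pp Pm * K1), lam.re < 0 :=
  ⟨-(Bone p q m P0 Pp Pm).conjTranspose, fun _ hlam =>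
    re_neg_of_mem_spectrum_sub_mul_conjTranspose _ _ (conjTranspose_GoneC p q ω)
      (eq_zero_of_vecMul_GoneC_of_vecMul_Bone p q m ω hω0 hωmono P0 Pp Pm hP0 hPp hPm) hlam⟩
end

section
/- Let X, U, Y be complex Banach spaces and let A : X → X, B : U → X, C : X → Y, D : U → Y, and K_0 : X → U be bounded linear operators. Let λ ∈ ℂ be such that both λI − A and λI − (A+BK_0) are boundedly invertible, and define P(λ) = C(λI−A)^{-1}B + D, G_K(λ) = K_0(λI−A)^{-1}B, and P_K(λ) = (C + DK_0)(λI−(A+BK_0))^{-1}B + D. Then I_U − G_K(λ) is boundedly invertible and P_K(λ) = P(λ)(I_U − G_K(λ))^{-1}. -/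
/-- The resolvent-type identities `S = R + R F S` and `S = R + S F R` for the inverses
`R = M⁻¹` and `S = (M - F)⁻¹` in a ring. -/
theorem Ring.inverse_sub_eq_add {R : Type*} [Ring R] {M F : R}
    (hM : IsUnit M) (hMF : IsUnit (M - F)) :
    Ring.inverse (M - F) = Ring.inverse M + Ring.inverse M * F * Ring.inverse (M - F) ∧
    Ring.inverse (M - F) = Ring.inverse M + Ring.inverse (M - F) * F * Ring.inverse M := by
  have hF : F = M - (M - F) := by abel
  constructor
  · have h : Ring.inverse M * (M - (M - F)) * Ring.inverse (M - F) =
        Ring.inverse (M - F) - Ring.inverse M := by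
      rw [mul_sub, Ring.inverse_mul_cancel _ hM, sub_mul, one_mul, mul_assoc,
        Ring.mul_inverse_cancel _ hMF, mul_one]
    rw [← hF] at h
    rw [h]
    abel
  · have h : Ring.inverse (M - F) * (M - (M - F)) * Ring.inverse M =
        Ring.inverse (M - F) - Ring.inverse M := by
      rw [mul_sub, Ring.inverse_mul_cancel _ hMF, sub_mul, one_mul, mul_assoc,
        Ring.mul_inverse_cancel _ hM, mul_one]
    rw [← hF] at h
    rw [h]
    abel

/-- With `P(λ) = C(λI-A)⁻¹B + D`, `G_K(λ) = K₀(λI-A)⁻¹B` and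
`P_K(λ) = (C + DK₀)(λI-(A+BK₀))⁻¹B + D`: if `λI - A` and `λI - (A+BK₀)` are
boundedly invertible, then `I_U - G_K(λ)` is boundedly invertible and
`P_K(λ) = P(λ) (I_U - G_K(λ))⁻¹`. -/
theorem transfer_function_feedback_formula {X U Y : Type*}
    [NormedAddCommGroup X] [NormedSpace ℂ X] [CompleteSpace X]
    [NormedAddCommGroup U] [NormedSpace ℂ U] [CompleteSpace U]
    [NormedAddCommGroup Y] [NormedSpace ℂ Y] [CompleteSpace Y]
    (A : X →L[ℂ] X) (B : U →L[ℂ] X) (C : X →L[ℂ] Y) (D : U →L[ℂ] Y)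
    (K0 : X →L[ℂ] U) (lam : ℂ)
    (hA : IsUnit (lam • (1 : X →L[ℂ] X) - A))
    (hAK : IsUnit (lam • (1 : X →L[ℂ] X) - (A + B.comp K0))) :
    IsUnit ((1 : U →L[ℂ] U) -
        (K0.comp (Ring.inverse (lam • (1 : X →L[ℂ] X) - A))).comp B) ∧
    ((C + D.comp K0).comp
        (Ring.inverse (lam • (1 : X →L[ℂ] X) - (A + B.comp K0)))).comp B + D =
      ((C.comp (Ring.inverse (lam • (1 : X →L[ℂ] X) - A))).comp B + D).comp
        (Ring.inverse ((1 : U →L[ℂ] U) -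
          (K0.comp (Ring.inverse (lam • (1 : X →L[ℂ] X) - A))).comp B)) := by
  rw [← sub_sub] at hAK ⊢
  obtain ⟨hl, hr⟩ := Ring.inverse_sub_eq_add hA hAK
  set R := Ring.inverse (lam • (1 : X →L[ℂ] X) - A)
  set S := Ring.inverse (lam • (1 : X →L[ℂ] X) - A - B.comp K0)
  have hl' (x : X) : R (B (K0 (S x))) = S x - R x :=
    eq_sub_of_add_eq' (DFunLike.congr_fun hl x).symm
  have hr' (x : X) : S (B (K0 (R x))) = S x - R x :=
    eq_sub_of_add_eq' (DFunLike.congr_fun hr x).symm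
  let u : (U →L[ℂ] U)ˣ :=
    { val := 1 - (K0.comp R).comp B
      inv := 1 + (K0.comp S).comp B
      val_inv := by
        ext x
        simp [hl']
      inv_val := by
        ext x
        simp [hr'] }
  refine ⟨u.isUnit, ?_⟩
  have hu : Ring.inverse (1 - (K0.comp R).comp B) = 1 + (K0.comp S).comp B :=
    Ring.inverse_unit u
  rw [hu]
  ext x
  simp [hl']
  abel
end

section
/- Let X be a complex Banach space, p ≥ 1, q ≥ 0, and let 0 = ω_0 < ω_1 < … < ω_q be real numbers. Let A : X → X and C : X → ℂ^p be bounded linear operators such that 0 and ±iω_k (k = 1,…,q) all lie in the resolvent set of A, and write R(λ,A) = (λI−A)^{-1}. Let G_1 = diag(0_p, ω_1Ω_p, …, ω_qΩ_p) with Ω_p = [[0_p, I_p], [−I_p, 0_p]], regarded as a linear map on ℂ^{p(2q+1)}, and let G_2 : ℂ^p → ℂ^{p(2q+1)} be given by the block column [I_p; I_p; 0_p; I_p; 0_p; …; I_p; 0_p]. Define the bounded operator H : X → ℂ^{p(2q+1)} whose first block component is C R(0,A) and whose subsequent block components, for each k = 1,…,q, are (C R(iω_k,A) + C R(−iω_k,A))/2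 and (iC R(iω_k,A) − iC R(−iω_k,A))/2. Then H satisfies the Sylvester equation G_1H = HA + G_2C. -/
/-- The internal model input matrix `G₂ = [I_p; I_p; 0_p; I_p; 0_p; …; I_p; 0_p]`. -/
def GtwoC (p q : ℕ) : Matrix (Fin p ⊕ ((Fin p ⊕ Fin p) × Fin q)) (Fin p) ℂ :=
  Matrix.of fun i j =>
    match i with
    | Sum.inl i' => if i' = j then 1 else 0
    | Sum.inr (Sum.inl i', _) => if i' = j then 1 else 0
    | Sum.inr (Sum.inr _, _) => 0

/-- The explicitly defined operator `H : X → ℂ^{p(2q+1)}` whose first block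
component is `C R(0,A)` and whose subsequent block components for each `k` are
`(C R(iω_k,A) + C R(-iω_k,A))/2` and `(i C R(iω_k,A) - i C R(-iω_k,A))/2`. -/
noncomputable def Hsol {X : Type*} [NormedAddCommGroup X] [NormedSpace ℂ X]
    (p q : ℕ) (ω : Fin (q + 1) → ℝ) (A : X →L[ℂ] X) (C : X →L[ℂ] (Fin p → ℂ)) :
    X →L[ℂ] ((Fin p ⊕ ((Fin p ⊕ Fin p) × Fin q)) → ℂ) :=
  ContinuousLinearMap.pi fun j =>
    match j with
    | Sum.inl i => (ContinuousLinearMap.proj i).comp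
        (C.comp (Ring.inverse ((0 : ℂ) • (1 : X →L[ℂ] X) - A)))
    | Sum.inr (Sum.inl i, k) => ((1 : ℂ) / 2) • ((ContinuousLinearMap.proj i).comp
        (C.comp (Ring.inverse (((ω k.succ : ℂ) * Complex.I) • (1 : X →L[ℂ] X) - A)) +
         C.comp (Ring.inverse ((-((ω k.succ : ℂ) * Complex.I)) • (1 : X →L[ℂ] X) - A))))
    | Sum.inr (Sum.inr i, k) => ((1 : ℂ) / 2) • ((ContinuousLinearMap.proj i).comp
        (Complex.I •
            C.comp (Ring.inverse (((ω k.succ : ℂ) * Complex.I) • (1 : X →L[ℂ] X) - A)) -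
         Complex.I •
            C.comp (Ring.inverse ((-((ω k.succ : ℂ) * Complex.I)) • (1 : X →L[ℂ] X) - A))))

/-- The resolvent identity `R(μ, A) A = μ R(μ, A) - I`, applied to a vector. -/
theorem ring_inverse_smul_one_sub_apply {X : Type*}
    [NormedAddCommGroup X] [NormedSpace ℂ X] {A : X →L[ℂ] X} {μ : ℂ}
    (hμ : μ ∉ spectrum ℂ A) (x : X) :
    Ring.inverse (μ • (1 : X →L[ℂ] X) - A) (A x) =
      μ • Ring.inverse (μ • (1 : X →L[ℂ] X) - A) x - x := by
  have hunit : IsUnit (μ • (1 : X →L[ℂ] X) - A) := by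
    simpa [Algebra.algebraMap_eq_smul_one] using spectrum.notMem_iff.mp hμ
  have hinv := congrArg (fun T : X →L[ℂ] X => T x) (Ring.inverse_mul_cancel _ hunit)
  simp only [mul_apply_eq_comp, sub_apply, smul_apply, one_apply_eq_self, map_sub,
    map_smul] at hinv
  rw [eq_sub_iff_add_eq, ← sub_eq_iff_eq_add'.mp hinv]

/-- The explicitly defined operator `H` solves the regulator Sylvester equation
`G₁ H = H A + G₂ C` associated with the internal model `(G₁, G₂)`. -/
theorem explicit_H_solves_sylvester {X : Type*}
    [NormedAddCommGroup X] [NormedSpace ℂ X] [CompleteSpace X]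
    (p q : ℕ) (hp : 1 ≤ p) (ω : Fin (q + 1) → ℝ) (hω0 : ω 0 = 0) (hωmono : StrictMono ω)
    (A : X →L[ℂ] X) (C : X →L[ℂ] (Fin p → ℂ))
    (h0 : (0 : ℂ) ∉ spectrum ℂ A)
    (hk : ∀ k : Fin q, ((ω k.succ : ℂ) * Complex.I) ∉ spectrum ℂ A ∧
      (-((ω k.succ : ℂ) * Complex.I)) ∉ spectrum ℂ A) :
    ∀ x : X,
      (GoneC p q ω).mulVec (Hsol p q ω A C x) =
        Hsol p q ω A C (A x) + (GtwoC p q).mulVec (C x) := by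
  intro x
  funext j
  rcases j with i | ⟨i | i, k⟩
  · simp [GoneC, GtwoC, Hsol, Matrix.mulVec, dotProduct, ring_inverse_smul_one_sub_apply h0,
      -zero_smul, -zero_sub]
  · have hplus := ring_inverse_smul_one_sub_apply (hk k).1 x
    have hminus := ring_inverse_smul_one_sub_apply (hk k).2 x
    simp [GoneC, GtwoC, OmegaBlockC, Hsol, Matrix.mulVec, dotProduct, Fintype.sum_prod_type,
      Matrix.blockDiagonal_apply, Matrix.one_apply, hplus, hminus, -neg_smul]
    ring
  · have hplus := ring_inverse_smul_one_sub_apply (hk k).1 x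
    have hminus := ring_inverse_smul_one_sub_apply (hk k).2 x
    simp [GoneC, GtwoC, OmegaBlockC, Hsol, Matrix.mulVec, dotProduct, Fintype.sum_prod_type,
      Matrix.blockDiagonal_apply, Matrix.one_apply, hplus, hminus, -neg_smul]
    ring_nf
    simp [Complex.I_sq]
    ring
end
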